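/- For each positive integer k, let B_k be the set of positive integers n such that k divides gcd(n, F_n) and every prime p dividing gcd(n, F_n) also divides k. Then the asymptotic density of B_k exists and equals the sum over all positive integers d coprime to k of μ(d)/ℓ(dk), and this series is absolutely convergent. -/

import Mathlib

open scoped BigOperators

/-- `fibZ m` is the rank of appearance of `m`: the least positive `n` with `m ∣ F_n`. -/
noncomputable def fibZ (m : ℕ) : ℕ := sInf {n : ℕ | 0 < n ∧ m ∣ Nat.fib n}

/-- `fibL m = lcm(m, z(m))`. -/
noncomputable def fibL (m : ℕ) : ℕ := Nat.lcm m (fibZ m)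

/-- `countIn S x` is the number of elements of `S` in `[1, x]`. -/
noncomputable def countIn (S : Set ℕ) (x : ℝ) : ℕ :=
  (S ∩ {n : ℕ | 1 ≤ n ∧ (n : ℝ) ≤ x}).ncard

/-- `S` has asymptotic density `a`. -/
def HasDensity (S : Set ℕ) (a : ℝ) : Prop :=
  Filter.Tendsto (fun x : ℝ => (countIn S x : ℝ) / x) Filter.atTop (nhds a)

/-- `fibA k` is the set of positive integers `n` with `gcd(n, F_n) = k`. -/
def fibA (k : ℕ) : Set ℕ := {n : ℕ | 0 < n ∧ Nat.gcd n (Nat.fib n) = k}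
/-- `fibB k` is the set of positive `n` such that `k ∣ gcd(n, F_n)` and every prime
dividing `gcd(n, F_n)` divides `k`. -/
def fibB (k : ℕ) : Set ℕ :=
  {n : ℕ | 0 < n ∧ k ∣ Nat.gcd n (Nat.fib n) ∧
    ∀ p : ℕ, p.Prime → p ∣ Nat.gcd n (Nat.fib n) → p ∣ k}

theorem exists_pos_dvd_fib {m : ℕ} (hm : 0 < m) : ∃ n, 0 < n ∧ m ∣ Nat.fib n := by
  have : NeZero m := ⟨hm.ne'⟩
  let f : ZMod m × ZMod m ≃ ZMod m × ZMod m :=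
    { toFun := fun x => (x.2, x.1 + x.2)
      invFun := fun x => (x.2 - x.1, x.1)
      left_inv := fun x => by simp
      right_inv := fun x => by simp }
  have key : ∀ n : ℕ, ((f : Equiv.Perm (ZMod m × ZMod m)) ^ n) (0, 1) =
      ((Nat.fib n : ZMod m), (Nat.fib (n + 1) : ZMod m)) := by
    intro n
    induction n with
    | zero => simp
    | succ n ih =>
      rw [pow_succ', Equiv.Perm.mul_apply, ih]
      simp [f, Nat.fib_add_two]
  refine ⟨orderOf (f : Equiv.Perm (ZMod m × ZMod m)), orderOf_pos _, ?_⟩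
  have h := key (orderOf (f : Equiv.Perm (ZMod m × ZMod m)))
  rw [pow_orderOf_eq_one] at h
  rw [← ZMod.natCast_eq_zero_iff]
  exact (congrArg Prod.fst h).symm

theorem fibZ_spec {m : ℕ} (hm : 0 < m) : 0 < fibZ m ∧ m ∣ Nat.fib (fibZ m) :=
  Nat.sInf_mem (s := {n : ℕ | 0 < n ∧ m ∣ Nat.fib n}) (exists_pos_dvd_fib hm)

theorem dvd_fib_iff {m : ℕ} (hm : 0 < m) (n : ℕ) : m ∣ Nat.fib n ↔ fibZ m ∣ n := by
  obtain ⟨hpos, hdvd⟩ := fibZ_spec hm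
  refine ⟨fun h => ?_, fun h => hdvd.trans (Nat.fib_dvd _ _ h)⟩
  have hg : m ∣ Nat.fib (Nat.gcd (fibZ m) n) := by
    rw [Nat.fib_gcd]; exact Nat.dvd_gcd hdvd h
  have hle : fibZ m ≤ Nat.gcd (fibZ m) n :=
    Nat.sInf_le ⟨Nat.gcd_pos_of_pos_left _ hpos, hg⟩
  rw [Nat.le_antisymm hle (Nat.gcd_le_left _ hpos)]
  exact Nat.gcd_dvd_right _ _

theorem fibL_dvd_iff {m : ℕ} (hm : 0 < m) (n : ℕ) : fibL m ∣ n ↔ m ∣ Nat.gcd n (Nat.fib n) := by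
  rw [fibL, Nat.lcm_dvd_iff, Nat.dvd_gcd_iff, dvd_fib_iff hm]

theorem fibL_pos {m : ℕ} (hm : 0 < m) : 0 < fibL m :=
  Nat.lcm_pos hm (fibZ_spec hm).1

theorem fibZ_dvd_of_dvd {a b : ℕ} (hb : 0 < b) (h : a ∣ b) : fibZ a ∣ fibZ b :=
  (dvd_fib_iff (Nat.pos_of_dvd_of_pos h hb) _).1 (h.trans (fibZ_spec hb).2)

theorem fibL_dvd_of_dvd {a b : ℕ} (hb : 0 < b) (h : a ∣ b) : fibL a ∣ fibL b :=
  lcm_dvd_lcm h (fibZ_dvd_of_dvd hb h)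

/-- Binet's formula over a field, with denominators cleared. -/
theorem pow_sub_pow_eq_sub_mul_fib {K : Type*} [Field K] {a : K} (ha : a ^ 2 = a + 1) (n : ℕ) :
    a ^ n - (1 - a) ^ n = (a - (1 - a)) * Nat.fib n := by
  induction n using Nat.twoStepInduction with
  | zero => simp
  | one => simp
  | more n ih1 ih2 =>
    rw [Nat.fib_add_two, Nat.cast_add, mul_add, ← ih1, ← ih2]
    linear_combination (a ^ n - (1 - a) ^ n) * ha

theorem eq_five_of_dvd_fibZ {p : ℕ} (hp : p.Prime) (h : p ∣ fibZ p) : p = 5 := by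
  have : Fact p.Prime := ⟨hp⟩
  obtain ⟨hpos, hdvd⟩ := fibZ_spec hp.pos
  obtain ⟨t, ht⟩ := h
  have ht0 : 0 < t := Nat.pos_of_ne_zero fun h0 => by simp [h0] at ht; omega
  obtain ⟨a, ha⟩ : ∃ a : AlgebraicClosure (ZMod p), a ^ 2 = a + 1 := by
    obtain ⟨a, ha⟩ := IsAlgClosed.exists_root
      (Polynomial.X ^ 2 - Polynomial.X - 1 : Polynomial (AlgebraicClosure (ZMod p)))
      (by
        have : (Polynomial.X ^ 2 - Polynomial.X - 1 :
            Polynomial (AlgebraicClosure (ZMod p))).degree = 2 := by compute_degree!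
        rw [this]; decide)
    refine ⟨a, ?_⟩
    simp only [Polynomial.IsRoot.def, Polynomial.eval_sub, Polynomial.eval_pow,
      Polynomial.eval_X, Polynomial.eval_one] at ha
    linear_combination ha
  have hfib : ((Nat.fib (fibZ p) : ℕ) : AlgebraicClosure (ZMod p)) = 0 :=
    (CharP.cast_eq_zero_iff _ p _).2 hdvd
  have h1 : (a ^ t - (1 - a) ^ t) ^ p = 0 := by
    rw [sub_pow_char, ← pow_mul, ← pow_mul, mul_comm t p, ← ht, pow_sub_pow_eq_sub_mul_fib ha,
      hfib, mul_zero]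
  have h2 := pow_eq_zero_iff hp.ne_zero |>.1 h1
  rw [pow_sub_pow_eq_sub_mul_fib ha, mul_eq_zero] at h2
  rcases h2 with h2 | h2
  · have h5 : ((5 : ℕ) : AlgebraicClosure (ZMod p)) = 0 := by
      push_cast
      linear_combination (2 * a - 1) * h2 - 4 * ha
    exact (Nat.prime_dvd_prime_iff_eq hp (by norm_num)).1 ((CharP.cast_eq_zero_iff _ p _).1 h5)
  · have h3 : p ∣ Nat.fib t := (CharP.cast_eq_zero_iff _ p _).1 h2
    have h4 := Nat.le_of_dvd ht0 ((dvd_fib_iff hp.pos t).1 h3)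
    have := hp.two_le
    nlinarith

theorem gcd_fibZ_le_five {p : ℕ} (hp : p.Prime) : Nat.gcd p (fibZ p) ≤ 5 := by
  rcases (Nat.dvd_prime hp).1 (Nat.gcd_dvd_left p (fibZ p)) with h | h
  · omega
  · have h5 := eq_five_of_dvd_fibZ hp (Nat.gcd_eq_left_iff_dvd.1 h)
    omega

theorem two_pow_card_primeFactors_le {n : ℕ} (hn : n ≠ 0) : 2 ^ n.primeFactors.card ≤ n :=
  (Finset.pow_card_le_prod n.primeFactors id 2
      fun _ hp => (Nat.prime_of_mem_primeFactors hp).two_le).trans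
    (Nat.le_of_dvd (Nat.pos_of_ne_zero hn) (Nat.prod_primeFactors_dvd n))

theorem fib_le_two_pow (n : ℕ) : Nat.fib n ≤ 2 ^ n := by
  induction n using Nat.twoStepInduction with
  | zero => simp
  | one => simp
  | more n ih1 ih2 => rw [Nat.fib_add_two]; rw [pow_succ] at *; omega

/-- At most `n` primes have rank of appearance `n`. -/
theorem card_primes_fibZ_eq_le {T : Finset ℕ} (hT : ∀ p ∈ T, p.Prime) (n : ℕ) :
    (T.filter fun p => fibZ p = n).card ≤ n := by
  rcases Nat.eq_zero_or_pos n with rfl | hn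
  · refine (Finset.card_eq_zero.2 (Finset.filter_eq_empty_iff.2 fun p hp => ?_)).le
    exact (fibZ_spec (hT p hp).pos).1.ne'
  have hsub : (T.filter fun p => fibZ p = n) ⊆ (Nat.fib n).primeFactors := by
    intro p hp
    rw [Finset.mem_filter] at hp
    have := (fibZ_spec (hT p hp.1).pos).2
    rw [hp.2] at this
    exact Nat.mem_primeFactors.2 ⟨hT p hp.1, this, (Nat.fib_pos.2 hn).ne'⟩
  refine (Finset.card_le_card hsub).trans ((Nat.pow_le_pow_iff_right one_lt_two).1 ?_)
  exact (two_pow_card_primeFactors_le (Nat.fib_pos.2 hn).ne').trans (fib_le_two_pow n)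

theorem prod_primes_one_add_inv_monotone :
    Monotone fun n : ℕ => ∏ q ∈ Finset.range n, if q.Prime then 1 + 1 / (q : ℝ) else 1 := by
  refine monotone_nat_of_le_succ fun n => ?_
  rw [Finset.prod_range_succ]
  refine le_mul_of_one_le_right (Finset.prod_nonneg fun q _ => ?_) ?_
  · split_ifs <;> positivity
  · split_ifs
    · simp
    · rfl

theorem prod_primes_one_add_inv_six_mul_pow_three_le (j : ℕ) :
    (∏ q ∈ Finset.range (6 * (j + 1)), if q.Prime then 1 + 1 / (q : ℝ) else 1) ^ 3
      ≤ 14 * ((j + 1 : ℕ) : ℝ) := by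
  induction j with
  | zero =>
    simp only [Finset.prod_range_succ, Finset.prod_range_zero]
    norm_num
  | succ j ih =>
    have hnp : ∀ d r : ℕ, d ≠ 1 → d ∣ 6 → d ∣ r → d < 6 → ¬ (6 * (j + 1) + r).Prime := by
      intro d r hd1 hd6 hdr hd hp
      rcases (Nat.dvd_prime hp).1 (dvd_add (hd6.mul_right _) hdr) with h | h <;> omega
    have h0 := hnp 2 0 (by norm_num) (by norm_num) (by norm_num) (by norm_num)
    have h2 := hnp 2 2 (by norm_num) (by norm_num) (by norm_num) (by norm_num)
    have h3 := hnp 3 3 (by norm_num) (by norm_num) (by norm_num) (by norm_num)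
    have h4 := hnp 2 4 (by norm_num) (by norm_num) (by norm_num) (by norm_num)
    rw [show 6 * (j + 1 + 1) = 6 * (j + 1) + 6 by ring]
    simp only [Finset.prod_range_succ _ (6 * (j + 1) + _), Finset.prod_range_succ _ (6 * (j + 1)),
      if_neg h2, if_neg h3, if_neg h4, mul_one]
    rw [add_zero] at h0
    rw [if_neg h0, mul_one]
    set P : ℝ := ∏ q ∈ Finset.range (6 * (j + 1)), if q.Prime then 1 + 1 / (q : ℝ) else 1 with hP
    have hP0 : 0 ≤ P := Finset.prod_nonneg fun q _ => by split_ifs <;> positivity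
    have hle : ∀ n : ℕ, (if n.Prime then 1 + 1 / (n : ℝ) else 1) ≤ 1 + 1 / (n : ℝ) := by
      intro n
      split_ifs
      · rfl
      · simp
    have hnn : ∀ n : ℕ, (0 : ℝ) ≤ if n.Prime then 1 + 1 / (n : ℝ) else 1 := by
      intro n
      split_ifs <;> positivity
    have hmul : (1 + 1 / ((6 * (j + 1) + 1 : ℕ) : ℝ)) ^ 3 * (1 + 1 / ((6 * (j + 1) + 5 : ℕ) : ℝ)) ^ 3
        ≤ ((j + 1 + 1 : ℕ) : ℝ) / ((j + 1 : ℕ) : ℝ) := by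
      push_cast
      have hx : (0 : ℝ) ≤ j := Nat.cast_nonneg j
      generalize (j : ℝ) = x at hx
      rw [one_add_div (by positivity), one_add_div (by positivity), div_pow, div_pow, div_mul_div_comm,
        div_le_div_iff₀ (by positivity) (by positivity), ← sub_nonneg]
      ring_nf
      positivity
    calc _ ≤ (P * (1 + 1 / ((6 * (j + 1) + 1 : ℕ) : ℝ)) *
          (1 + 1 / ((6 * (j + 1) + 5 : ℕ) : ℝ))) ^ 3 := by
          refine pow_le_pow_left₀ (mul_nonneg (mul_nonneg hP0 (hnn _)) (hnn _)) ?_ 3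
          exact mul_le_mul (mul_le_mul_of_nonneg_left (hle _) hP0) (hle _) (hnn _)
            (mul_nonneg hP0 (by positivity))
      _ = P ^ 3 * ((1 + 1 / ((6 * (j + 1) + 1 : ℕ) : ℝ)) ^ 3 *
          (1 + 1 / ((6 * (j + 1) + 5 : ℕ) : ℝ)) ^ 3) := by ring
      _ ≤ (14 * ((j + 1 : ℕ) : ℝ)) * (((j + 1 + 1 : ℕ) : ℝ) / ((j + 1 : ℕ) : ℝ)) := by
          gcongr
      _ = _ := by
          have : ((j + 1 : ℕ) : ℝ) ≠ 0 := by positivity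
          field_simp

theorem prod_primes_one_add_inv_pow_three_le {n : ℕ} (hn : 0 < n) :
    (∏ q ∈ Finset.range n, if q.Prime then 1 + 1 / (q : ℝ) else 1) ^ 3 ≤ 14 * (n : ℝ) := by
  have h1 := prod_primes_one_add_inv_monotone (show n ≤ 6 * (n / 6 + 1) by omega)
  have h2 := prod_primes_one_add_inv_six_mul_pow_three_le (n / 6)
  have h3 : ((n / 6 + 1 : ℕ) : ℝ) ≤ n := by exact_mod_cast (by omega : n / 6 + 1 ≤ n)
  have h0 : 0 ≤ ∏ q ∈ Finset.range n, if q.Prime then 1 + 1 / (q : ℝ) else 1 :=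
    Finset.prod_nonneg fun q _ => by split_ifs <;> positivity
  calc _ ≤ _ := pow_le_pow_left₀ h0 h1 3
    _ ≤ _ := h2
    _ ≤ _ := by gcongr

theorem sixteen_pow_card_primeFactors_le {n : ℕ} (hn : n ≠ 0) :
    16 ^ n.primeFactors.card ≤ 16 ^ 6 * n := by
  rw [← Finset.card_filter_add_card_filter_not (s := n.primeFactors) (fun q => q < 16), pow_add]
  refine Nat.mul_le_mul (Nat.pow_le_pow_right (by norm_num) ?_) ?_
  · have hsub : n.primeFactors.filter (fun q => q < 16) ⊆ Nat.primesBelow 16 := fun q hq => by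
      rw [Finset.mem_filter] at hq
      exact Nat.mem_primesBelow.2 ⟨hq.2, Nat.prime_of_mem_primeFactors hq.1⟩
    exact (Finset.card_le_card hsub).trans (by decide)
  · refine (Finset.pow_card_le_prod _ id 16 fun q hq => ?_).trans
      (Nat.le_of_dvd (Nat.pos_of_ne_zero hn)
        ((Finset.prod_dvd_prod_of_subset _ _ id (Finset.filter_subset _ _)).trans
          (Nat.prod_primeFactors_dvd n)))
    exact not_lt.1 (Finset.mem_filter.1 hq).2

theorem prod_primes_one_add_gcd_div_le {z : ℕ} (hz : z ≠ 0) (n : ℕ) :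
    ∏ q ∈ Finset.range n with q.Prime, (1 + (Nat.gcd q z : ℝ) / q) ≤
      (∏ q ∈ Finset.range n, if q.Prime then 1 + 1 / (q : ℝ) else 1) *
        2 ^ z.primeFactors.card := by
  have hdiv : ∏ q ∈ Finset.range n with q.Prime, (if q ∣ z then (2 : ℝ) else 1) ≤
      2 ^ z.primeFactors.card := by
    rw [← Finset.prod_filter, Finset.prod_const]
    refine pow_le_pow_right₀ (by norm_num) (Finset.card_le_card fun q hq => ?_)
    simp only [Finset.mem_filter] at hq
    exact Nat.mem_primeFactors.2 ⟨hq.1.2, hq.2, hz⟩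
  rw [← Finset.prod_filter]
  calc _ ≤ ∏ q ∈ Finset.range n with q.Prime, ((1 + 1 / (q : ℝ)) * if q ∣ z then 2 else 1) := by
        refine Finset.prod_le_prod (fun q _ => by positivity) fun q hq => ?_
        have hq' := (Finset.mem_filter.1 hq).2
        have hq0 : (0 : ℝ) < q := by exact_mod_cast hq'.pos
        split_ifs with h
        · rw [Nat.gcd_eq_left h, div_self hq0.ne']
          have : 0 ≤ 1 / (q : ℝ) := by positivity
          linarith
        · rw [(Nat.Prime.coprime_iff_not_dvd hq').2 h]
          simp
    _ = _ := Finset.prod_mul_distrib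
    _ ≤ _ := by
        gcongr

/-- The multiplicative function `n ↦ gcd(n, z) / n`. -/
noncomputable def gcdDiv (z : ℕ) : ArithmeticFunction ℝ :=
  ⟨fun n => (Nat.gcd n z : ℝ) / n, by simp⟩

theorem gcdDiv_apply (z n : ℕ) : gcdDiv z n = (Nat.gcd n z : ℝ) / n := rfl

theorem gcdDiv_isMultiplicative (z : ℕ) : (gcdDiv z).IsMultiplicative := by
  refine ⟨by simp [gcdDiv_apply], fun {m n} h => ?_⟩
  rw [gcdDiv_apply, gcdDiv_apply, gcdDiv_apply, Nat.gcd_comm, h.gcd_mul, Nat.gcd_comm z m,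
    Nat.gcd_comm z n, div_mul_div_comm]
  push_cast
  rfl

theorem gcdDiv_nonneg (z n : ℕ) : 0 ≤ gcdDiv z n := by
  rw [gcdDiv_apply]; positivity

theorem inv_fibL_le {p d : ℕ} (hd : 0 < d) (hpd : p ∣ d) :
    1 / (fibL d : ℝ) ≤ gcdDiv (fibZ p) d / fibZ p := by
  have hz := (fibZ_spec (Nat.pos_of_dvd_of_pos hpd hd)).1
  have hle : Nat.lcm d (fibZ p) ≤ fibL d :=
    Nat.le_of_dvd (fibL_pos hd) (lcm_dvd_lcm dvd_rfl (fibZ_dvd_of_dvd hd hpd))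
  have hl : 0 < Nat.lcm d (fibZ p) := Nat.lcm_pos hd hz
  have hmul : (Nat.gcd d (fibZ p) : ℝ) * Nat.lcm d (fibZ p) = d * fibZ p := by
    exact_mod_cast Nat.gcd_mul_lcm d (fibZ p)
  have hd' : (0 : ℝ) < d := by exact_mod_cast hd
  have hz' : (0 : ℝ) < fibZ p := by exact_mod_cast hz
  have hl' : (0 : ℝ) < Nat.lcm d (fibZ p) := by exact_mod_cast hl
  calc 1 / (fibL d : ℝ) ≤ 1 / (Nat.lcm d (fibZ p) : ℝ) :=
        one_div_le_one_div_of_le hl' (by exact_mod_cast hle)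
    _ = _ := by
        rw [gcdDiv_apply, div_div, ← hmul]
        have : (Nat.gcd d (fibZ p) : ℝ) ≠ 0 := by
          exact_mod_cast (Nat.gcd_pos_of_pos_left _ hd).ne'
        field_simp

theorem sum_inv_fibL_le_prod {p : ℕ} (hp : p.Prime) {D : Finset ℕ}
    (hD : ∀ d ∈ D, Squarefree d ∧ p ∣ d ∧ ∀ q, q.Prime → q ∣ d → q ≤ p) :
    ∑ d ∈ D, 1 / (fibL d : ℝ) ≤
      5 / (p * fibZ p) * ∏ q ∈ Finset.range p with q.Prime,
        (1 + (Nat.gcd q (fibZ p) : ℝ) / q) := by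
  have hsub : D ⊆ (primorial (p - 1)).divisors.image (p * ·) := by
    intro d hd
    obtain ⟨hsq, ⟨e, rfl⟩, hmax⟩ := hD d hd
    refine Finset.mem_image.2 ⟨e, Nat.mem_divisors.2 ⟨?_, primorial_ne_zero _⟩, rfl⟩
    have hcop : Nat.Coprime p e := Nat.coprime_of_squarefree_mul hsq
    have hesq : Squarefree e := hsq.squarefree_of_dvd (dvd_mul_left e p)
    rw [← Nat.prod_primeFactors_of_squarefree hesq, primorial]
    refine Finset.prod_dvd_prod_of_subset _ _ _ fun q hq => ?_
    have hqp := Nat.prime_of_mem_primeFactors hq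
    have hqe := Nat.dvd_of_mem_primeFactors hq
    have hle := hmax q hqp (hqe.mul_left p)
    have hne : q ≠ p := by
      rintro rfl
      exact (Nat.Prime.coprime_iff_not_dvd hp).1 hcop hqe
    rw [Finset.mem_filter, Finset.mem_range]
    exact ⟨by omega, hqp⟩
  have hp0 : (0 : ℝ) < p := by exact_mod_cast hp.pos
  have hz0 : (0 : ℝ) < fibZ p := by exact_mod_cast (fibZ_spec hp.pos).1
  calc ∑ d ∈ D, 1 / (fibL d : ℝ) ≤ ∑ d ∈ D, gcdDiv (fibZ p) d / fibZ p :=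
        Finset.sum_le_sum fun d hd =>
          inv_fibL_le (Nat.pos_of_ne_zero (hD d hd).1.ne_zero) (hD d hd).2.1
    _ ≤ ∑ d ∈ (primorial (p - 1)).divisors.image (p * ·), gcdDiv (fibZ p) d / fibZ p :=
        Finset.sum_le_sum_of_subset_of_nonneg hsub fun d _ _ =>
          div_nonneg (gcdDiv_nonneg _ _) hz0.le
    _ = ∑ e ∈ (primorial (p - 1)).divisors, gcdDiv (fibZ p) (p * e) / fibZ p :=
        Finset.sum_image fun a _ b _ h => Nat.eq_of_mul_eq_mul_left hp.pos h
    _ = ∑ e ∈ (primorial (p - 1)).divisors,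
          gcdDiv (fibZ p) p / fibZ p * gcdDiv (fibZ p) e := by
        refine Finset.sum_congr rfl fun e he => ?_
        have hcop : Nat.Coprime p e := by
          refine (Nat.Prime.coprime_iff_not_dvd hp).2 fun h => ?_
          have := hp.dvd_primorial_iff.1 (h.trans (Nat.dvd_of_mem_divisors he))
          have := hp.pos
          omega
        rw [(gcdDiv_isMultiplicative _).map_mul_of_coprime hcop]
        ring
    _ = gcdDiv (fibZ p) p / fibZ p * ∏ q ∈ Finset.range p with q.Prime,
        (1 + (Nat.gcd q (fibZ p) : ℝ) / q) := by
        rw [← Finset.mul_sum, ← (gcdDiv_isMultiplicative _).prodPrimeFactors_one_add_of_squarefree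
          (squarefree_primorial _), primeFactors_primorial, Nat.primesLE,
          Nat.sub_add_cancel hp.one_le]
        rfl
    _ ≤ _ := by
        refine mul_le_mul_of_nonneg_right ?_ (Finset.prod_nonneg fun q _ => by positivity)
        rw [gcdDiv_apply, div_div]
        gcongr
        exact_mod_cast gcd_fibZ_le_five hp

theorem sum_inv_fibL_le {p : ℕ} (hp : p.Prime) {D : Finset ℕ}
    (hD : ∀ d ∈ D, Squarefree d ∧ p ∣ d ∧ ∀ q, q.Prime → q ∣ d → q ≤ p) :
    ∑ d ∈ D, 1 / (fibL d : ℝ) ≤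
      960 * ((p : ℝ) ^ (-(2 / 3) : ℝ) * (fibZ p : ℝ) ^ (-(3 / 4) : ℝ)) := by
  have hz := (fibZ_spec hp.pos).1
  have hp0 : (0 : ℝ) < p := by exact_mod_cast hp.pos
  have hz0 : (0 : ℝ) < fibZ p := by exact_mod_cast hz
  have hG : (∏ q ∈ Finset.range p, if q.Prime then 1 + 1 / (q : ℝ) else 1) ≤
      3 * (p : ℝ) ^ (1 / 3 : ℝ) := by
    refine le_of_pow_le_pow_left₀ (n := 3) (by norm_num) (by positivity) ?_
    refine (prod_primes_one_add_inv_pow_three_le hp.pos).trans ?_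
    rw [mul_pow, ← Real.rpow_natCast ((p : ℝ) ^ (1 / 3 : ℝ)) 3, ← Real.rpow_mul hp0.le]
    norm_num
    linarith
  have hW : (2 : ℝ) ^ (fibZ p).primeFactors.card ≤ 64 * (fibZ p : ℝ) ^ (1 / 4 : ℝ) := by
    refine le_of_pow_le_pow_left₀ (n := 4) (by norm_num) (by positivity) ?_
    rw [mul_pow, ← Real.rpow_natCast ((fibZ p : ℝ) ^ (1 / 4 : ℝ)) 4, ← Real.rpow_mul hz0.le,
      ← pow_mul, mul_comm _ 4, pow_mul]
    have h : ((16 ^ (fibZ p).primeFactors.card : ℕ) : ℝ) ≤ ((16 ^ 6 * fibZ p : ℕ) : ℝ) := by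
      exact_mod_cast sixteen_pow_card_primeFactors_le hz.ne'
    push_cast at h
    norm_num at h ⊢
    exact h
  have e1 : (p : ℝ) ^ (-(2 / 3) : ℝ) = (p : ℝ) ^ (1 / 3 : ℝ) / p := by
    rw [← Real.rpow_sub_one hp0.ne']; norm_num
  have e2 : (fibZ p : ℝ) ^ (-(3 / 4) : ℝ) = (fibZ p : ℝ) ^ (1 / 4 : ℝ) / fibZ p := by
    rw [← Real.rpow_sub_one hz0.ne']; norm_num
  calc _ ≤ _ := sum_inv_fibL_le_prod hp hD
    _ ≤ 5 / (p * fibZ p) * ((3 * (p : ℝ) ^ (1 / 3 : ℝ)) * (64 * (fibZ p : ℝ) ^ (1 / 4 : ℝ))) := by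
        refine mul_le_mul_of_nonneg_left ((prod_primes_one_add_gcd_div_le hz.ne' p).trans ?_)
          (by positivity)
        gcongr
    _ = _ := by
        rw [e1, e2]
        field_simp
        norm_num

theorem sum_primes_rpow_fibZ_le {T : Finset ℕ} (hT : ∀ p ∈ T, p.Prime) :
    ∑ p ∈ T, (fibZ p : ℝ) ^ (-(15 / 7) : ℝ) ≤ ∑' n : ℕ, (n : ℝ) ^ (-(8 / 7) : ℝ) := by
  have hs : Summable fun n : ℕ => (n : ℝ) ^ (-(8 / 7) : ℝ) :=
    Real.summable_nat_rpow.2 (by norm_num)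
  calc ∑ p ∈ T, (fibZ p : ℝ) ^ (-(15 / 7) : ℝ)
      = ∑ n ∈ T.image fibZ, ((T.filter fun p => fibZ p = n).card : ℝ) *
          (n : ℝ) ^ (-(15 / 7) : ℝ) := by
        rw [Finset.sum_comp (fun n : ℕ => (n : ℝ) ^ (-(15 / 7) : ℝ)) fibZ]
        simp
    _ ≤ ∑ n ∈ T.image fibZ, (n : ℝ) ^ (-(8 / 7) : ℝ) := by
        refine Finset.sum_le_sum fun n hn => ?_
        obtain ⟨p, hp, rfl⟩ := Finset.mem_image.1 hn
        have hz0 : (0 : ℝ) < fibZ p := by exact_mod_cast (fibZ_spec (hT p hp).pos).1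
        calc _ ≤ (fibZ p : ℝ) * (fibZ p : ℝ) ^ (-(15 / 7) : ℝ) := by
              gcongr
              exact_mod_cast card_primes_fibZ_eq_le hT _
          _ = _ := by
              rw [mul_comm, ← Real.rpow_add_one hz0.ne']
              norm_num
    _ ≤ _ := hs.sum_le_tsum _ fun n _ => by positivity

theorem exists_sum_primes_le : ∃ C : ℝ, ∀ T : Finset ℕ, (∀ p ∈ T, p.Prime) →
    ∑ p ∈ T, (p : ℝ) ^ (-(2 / 3) : ℝ) * (fibZ p : ℝ) ^ (-(3 / 4) : ℝ) ≤ C := by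
  have hs : Summable fun n : ℕ => (n : ℝ) ^ (-(40 / 39) : ℝ) :=
    Real.summable_nat_rpow.2 (by norm_num)
  refine ⟨∑' n : ℕ, (n : ℝ) ^ (-(40 / 39) : ℝ) + ∑' n : ℕ, (n : ℝ) ^ (-(8 / 7) : ℝ),
    fun T hT => ?_⟩
  calc _ ≤ ∑ p ∈ T, ((p : ℝ) ^ (-(40 / 39) : ℝ) + (fibZ p : ℝ) ^ (-(15 / 7) : ℝ)) := by
        refine Finset.sum_le_sum fun p _ => ?_
        have h := Real.geom_mean_le_arith_mean2_weighted (w₁ := 13 / 20) (w₂ := 7 / 20)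
          (p₁ := (p : ℝ) ^ (-(40 / 39) : ℝ)) (p₂ := (fibZ p : ℝ) ^ (-(15 / 7) : ℝ))
          (by norm_num) (by norm_num) (by positivity) (by positivity) (by norm_num)
        rw [← Real.rpow_mul (Nat.cast_nonneg _), ← Real.rpow_mul (Nat.cast_nonneg _)] at h
        norm_num at h
        have h1 : (0 : ℝ) ≤ (p : ℝ) ^ (-(40 / 39) : ℝ) := by positivity
        have h2 : (0 : ℝ) ≤ (fibZ p : ℝ) ^ (-(15 / 7) : ℝ) := by positivity
        linarith
    _ ≤ _ := by
        rw [Finset.sum_add_distrib]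
        exact add_le_add (hs.sum_le_tsum _ fun n _ => by positivity) (sum_primes_rpow_fibZ_le hT)

theorem exists_max_prime_dvd {d : ℕ} (hd : 1 < d) :
    ∃ p, p.Prime ∧ p ∣ d ∧ ∀ q, q.Prime → q ∣ d → q ≤ p := by
  have hne : d.primeFactors.Nonempty := Nat.nonempty_primeFactors.2 hd
  have hmem := Finset.max'_mem _ hne
  refine ⟨d.primeFactors.max' hne, Nat.prime_of_mem_primeFactors hmem,
    Nat.dvd_of_mem_primeFactors hmem, fun q hq hqd => Finset.le_max' _ _ ?_⟩
  exact Nat.mem_primeFactors.2 ⟨hq, hqd, by omega⟩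

theorem summable_squarefree_inv_fibL :
    Summable fun d : ℕ => if Squarefree d then 1 / (fibL d : ℝ) else 0 := by
  obtain ⟨C, hC⟩ := exists_sum_primes_le
  choose! P hP using fun (d : ℕ) (hd : 1 < d) => exists_max_prime_dvd hd
  refine summable_of_sum_le (c := 1 / (fibL 1 : ℝ) + 960 * C)
    (fun d => by dsimp only; split_ifs <;> positivity) fun u => ?_
  rw [← Finset.sum_filter]
  set D := (u.filter fun d => Squarefree d).erase 1 with hDdef
  have hD : ∀ d ∈ D, Squarefree d ∧ 1 < d := by
    intro d hd
    simp only [hDdef, Finset.mem_erase, Finset.mem_filter] at hd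
    have := hd.2.2.ne_zero
    exact ⟨hd.2.2, by omega⟩
  have hT : ∀ p ∈ D.image P, p.Prime := by
    intro p hp
    obtain ⟨d, hd, rfl⟩ := Finset.mem_image.1 hp
    exact (hP d (hD d hd).2).1
  calc _ ≤ ∑ d ∈ insert 1 D, 1 / (fibL d : ℝ) := by
        refine Finset.sum_le_sum_of_subset_of_nonneg ?_ fun d _ _ => by positivity
        intro d hd
        rcases eq_or_ne d 1 with rfl | h1
        · exact Finset.mem_insert_self _ _
        · exact Finset.mem_insert_of_mem (Finset.mem_erase.2 ⟨h1, hd⟩)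
    _ = 1 / (fibL 1 : ℝ) + ∑ d ∈ D, 1 / (fibL d : ℝ) :=
        Finset.sum_insert (Finset.notMem_erase _ _)
    _ = 1 / (fibL 1 : ℝ) + ∑ p ∈ D.image P, ∑ d ∈ D with P d = p, 1 / (fibL d : ℝ) := by
        rw [Finset.sum_fiberwise_of_maps_to fun d hd => Finset.mem_image_of_mem P hd]
    _ ≤ 1 / (fibL 1 : ℝ) + ∑ p ∈ D.image P,
          960 * ((p : ℝ) ^ (-(2 / 3) : ℝ) * (fibZ p : ℝ) ^ (-(3 / 4) : ℝ)) := by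
        gcongr with p hp
        refine sum_inv_fibL_le (hT p hp) fun d hd => ?_
        obtain ⟨hdD, hdp⟩ := Finset.mem_filter.1 hd
        rw [← hdp]
        exact ⟨(hD d hdD).1, (hP d (hD d hdD).2).2⟩
    _ ≤ _ := by
        rw [← Finset.mul_sum]
        gcongr
        exact hC _ hT

theorem sum_divisors_coprime_moebius {g : ℕ} (hg : 0 < g) (k : ℕ)
    [Decidable (∀ p : ℕ, p.Prime → p ∣ g → p ∣ k)] :
    ∑ d ∈ g.divisors with Nat.Coprime d k, ArithmeticFunction.moebius d =
      if ∀ p : ℕ, p.Prime → p ∣ g → p ∣ k then 1 else 0 := by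
  set s := g.primeFactors.filter fun p => ¬ p ∣ k with hs
  have hsp : ∀ p ∈ s, p.Prime := fun p hp =>
    Nat.prime_of_mem_primeFactors (Finset.mem_filter.1 hp).1
  have hr0 : ∏ p ∈ s, p ≠ 0 := Finset.prod_ne_zero_iff.2 fun p hp => (hsp p hp).ne_zero
  have hrg : ∏ p ∈ s, p ∣ g :=
    (Finset.prod_dvd_prod_of_subset _ _ _ (Finset.filter_subset _ _)).trans
      (Nat.prod_primeFactors_dvd g)
  have hrk : Nat.Coprime (∏ p ∈ s, p) k :=
    Nat.Coprime.prod_left fun p hp =>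
      (Nat.Prime.coprime_iff_not_dvd (hsp p hp)).2 (Finset.mem_filter.1 hp).2
  have hsub : (∏ p ∈ s, p).divisors ⊆ g.divisors.filter fun d => Nat.Coprime d k := by
    intro d hd
    have hdr := Nat.dvd_of_mem_divisors hd
    exact Finset.mem_filter.2
      ⟨Nat.mem_divisors.2 ⟨hdr.trans hrg, hg.ne'⟩, hrk.coprime_dvd_left hdr⟩
  rw [← Finset.sum_subset hsub, ← ArithmeticFunction.coe_mul_zeta_apply,
    ArithmeticFunction.moebius_mul_coe_zeta, ArithmeticFunction.one_apply]
  · refine if_congr ?_ rfl rfl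
    constructor
    · intro h p hp hpg
      by_contra hpk
      have : p ∣ ∏ p ∈ s, p := Finset.dvd_prod_of_mem _
        (Finset.mem_filter.2 ⟨Nat.mem_primeFactors.2 ⟨hp, hpg, hg.ne'⟩, hpk⟩)
      rw [h] at this
      exact hp.one_lt.ne' (Nat.dvd_one.1 this)
    · intro h
      have : s = ∅ := Finset.filter_eq_empty_iff.2 fun p hp => not_not.2
        (h p (Nat.prime_of_mem_primeFactors hp) (Nat.dvd_of_mem_primeFactors hp))
      rw [this, Finset.prod_empty]
  · intro d hd hdr
    refine ArithmeticFunction.moebius_eq_zero_of_not_squarefree fun hsq => hdr ?_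
    obtain ⟨hdg, hdk⟩ := Finset.mem_filter.1 hd
    refine Nat.mem_divisors.2 ⟨?_, hr0⟩
    rw [← Nat.prod_primeFactors_of_squarefree hsq]
    refine Finset.prod_dvd_prod_of_subset _ _ _ fun p hp => ?_
    have hpp := Nat.prime_of_mem_primeFactors hp
    have hpd := Nat.dvd_of_mem_primeFactors hp
    exact Finset.mem_filter.2
      ⟨Nat.mem_primeFactors.2 ⟨hpp, hpd.trans (Nat.dvd_of_mem_divisors hdg), hg.ne'⟩, fun hpk =>
        Nat.not_coprime_of_dvd_of_dvd hpp.one_lt hpd hpk hdk⟩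

open Classical in
theorem fibB_indicator_eq_sum {k n N : ℕ} (hk : 0 < k) (hn : 0 < n) (hnN : n ≤ N) :
    (if n ∈ fibB k then (1 : ℤ) else 0) =
      ∑ d ∈ Finset.range (N + 1), if fibL (d * k) ∣ n then
        (if Nat.Coprime d k then ArithmeticFunction.moebius d else 0) else 0 := by
  have hg : 0 < Nat.gcd n (Nat.fib n) := Nat.gcd_pos_of_pos_left _ hn
  have hmem : n ∈ fibB k ↔ k ∣ Nat.gcd n (Nat.fib n) ∧
      ∀ p : ℕ, p.Prime → p ∣ Nat.gcd n (Nat.fib n) → p ∣ k := by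
    simp [fibB, hn]
  have hiff : ∀ d, 0 < d → Nat.Coprime d k → (fibL (d * k) ∣ n ↔
      d ∣ Nat.gcd n (Nat.fib n) ∧ k ∣ Nat.gcd n (Nat.fib n)) := by
    intro d hd hdk
    rw [fibL_dvd_iff (Nat.mul_pos hd hk)]
    exact ⟨fun h => ⟨(dvd_mul_right _ _).trans h, (dvd_mul_left _ _).trans h⟩,
      fun h => hdk.mul_dvd_of_dvd_of_dvd h.1 h.2⟩
  by_cases hkg : k ∣ Nat.gcd n (Nat.fib n)
  · simp only [hmem, hkg, true_and]
    rw [← sum_divisors_coprime_moebius hg k, Finset.sum_filter]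
    symm
    have hsub : (Nat.gcd n (Nat.fib n)).divisors ⊆ Finset.range (N + 1) := by
      intro d hd
      have := Nat.le_of_dvd hn ((Nat.dvd_of_mem_divisors hd).trans (Nat.gcd_dvd_left _ _))
      exact Finset.mem_range.2 (by omega)
    rw [← Finset.sum_subset hsub]
    · refine Finset.sum_congr rfl fun d hd => ?_
      split_ifs with h1 h2 h2
      · rfl
      · rfl
      · exact absurd ((hiff d (Nat.pos_of_mem_divisors hd) h2).2
          ⟨Nat.dvd_of_mem_divisors hd, hkg⟩) h1
      · rfl
    · intro d _ hd
      rcases Nat.eq_zero_or_pos d with rfl | hd0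
      · simp
      split_ifs with h1 h2
      · exact absurd (Nat.mem_divisors.2 ⟨((hiff d hd0 h2).1 h1).1, hg.ne'⟩) hd
      · rfl
      · rfl
  · rw [if_neg fun h => hkg (hmem.1 h).1]
    symm
    refine Finset.sum_eq_zero fun d _ => ?_
    rcases Nat.eq_zero_or_pos d with rfl | hd0
    · simp
    split_ifs with h1 h2
    · exact absurd ((hiff d hd0 h2).1 h1).2 hkg
    · rfl
    · rfl

theorem countIn_fibB_eq_sum {k : ℕ} (hk : 0 < k) {x : ℝ} (hx : 0 ≤ x) :
    (countIn (fibB k) x : ℤ) = ∑ d ∈ Finset.range (⌊x⌋₊ + 1),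
      (if Nat.Coprime d k then ArithmeticFunction.moebius d else 0) *
        (⌊x⌋₊ / fibL (d * k) : ℕ) := by
  classical
  have hset : fibB k ∩ {n : ℕ | 1 ≤ n ∧ (n : ℝ) ≤ x} =
      ((Finset.Ioc 0 ⌊x⌋₊).filter fun n => n ∈ fibB k : Finset ℕ) := by
    ext n
    simp only [Set.mem_inter_iff, Set.mem_ofPred_eq, Finset.coe_filter, Finset.mem_Ioc,
      Nat.le_floor_iff hx, Nat.succ_le_iff]
    tauto
  rw [countIn, hset, Set.ncard_coe_finset, Finset.card_filter, Nat.cast_sum]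
  push_cast
  calc _ = ∑ n ∈ Finset.Ioc 0 ⌊x⌋₊, ∑ d ∈ Finset.range (⌊x⌋₊ + 1),
        (if fibL (d * k) ∣ n then
          (if Nat.Coprime d k then ArithmeticFunction.moebius d else 0) else 0) :=
        Finset.sum_congr rfl fun n hn =>
          fibB_indicator_eq_sum hk (Finset.mem_Ioc.1 hn).1 (Finset.mem_Ioc.1 hn).2
    _ = _ := by
        rw [Finset.sum_comm]
        refine Finset.sum_congr rfl fun d _ => ?_
        rw [← Finset.sum_filter, Finset.sum_const, Nat.Ioc_filter_dvd_card_eq_div, nsmul_eq_mul,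
          mul_comm]
        push_cast
        rfl

theorem countIn_fibB_eq_tsum {k : ℕ} (hk : 0 < k) {x : ℝ} (hx : 0 ≤ x) :
    (countIn (fibB k) x : ℝ) = ∑' d : ℕ,
      (if Nat.Coprime d k then (ArithmeticFunction.moebius d : ℝ) else 0) *
        (⌊x⌋₊ / fibL (d * k) : ℕ) := by
  rw [tsum_eq_sum (s := Finset.range (⌊x⌋₊ + 1))]
  · have h := congrArg (Int.cast (R := ℝ)) (countIn_fibB_eq_sum hk hx)
    rw [Int.cast_natCast] at h
    rw [h, Int.cast_sum]
    refine Finset.sum_congr rfl fun d _ => ?_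
    rw [Int.cast_mul, Int.cast_natCast, Int.cast_ite, Int.cast_zero]
  · intro d hd
    have hlt : ⌊x⌋₊ < d := by
      rw [Finset.mem_range] at hd
      omega
    have hdk : 0 < d * k := Nat.mul_pos (by omega) hk
    have h1 : d ≤ fibL (d * k) :=
      (Nat.le_mul_of_pos_right d hk).trans
        (Nat.le_of_dvd (fibL_pos hdk) (Nat.dvd_lcm_left _ _))
    rw [Nat.div_eq_of_lt (hlt.trans_le h1)]
    simp

theorem density_of_fibB (k : ℕ) (hk : 0 < k) :
    Summable (fun d : ℕ =>
        if Nat.Coprime d k then (ArithmeticFunction.moebius d : ℝ) / (fibL (d * k) : ℝ)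
        else 0) ∧
      Summable (fun d : ℕ =>
        |if Nat.Coprime d k then (ArithmeticFunction.moebius d : ℝ) / (fibL (d * k) : ℝ)
        else 0|) ∧
      HasDensity (fibB k)
        (∑' d : ℕ, if Nat.Coprime d k then
          (ArithmeticFunction.moebius d : ℝ) / (fibL (d * k) : ℝ) else 0) := by
  have habs : Summable (fun d : ℕ =>
      |if Nat.Coprime d k then (ArithmeticFunction.moebius d : ℝ) / (fibL (d * k) : ℝ)
      else 0|) := by
    refine Summable.of_nonneg_of_le (fun d => abs_nonneg _) (fun d => ?_)
      summable_squarefree_inv_fibL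
    by_cases hsq : Squarefree d
    · have hd : 0 < d := Nat.pos_of_ne_zero hsq.ne_zero
      have hdk : 0 < d * k := Nat.mul_pos hd hk
      have hle : (fibL d : ℝ) ≤ fibL (d * k) := by
        exact_mod_cast Nat.le_of_dvd (fibL_pos hdk) (fibL_dvd_of_dvd hdk (dvd_mul_right d k))
      have hl : (0 : ℝ) < fibL d := by exact_mod_cast fibL_pos hd
      have hmu : |(ArithmeticFunction.moebius d : ℝ)| ≤ 1 := by
        exact_mod_cast ArithmeticFunction.abs_moebius_le_one (n := d)
      rw [if_pos hsq]
      split_ifs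
      · rw [abs_div, abs_of_nonneg (hl.le.trans hle)]
        gcongr
      · rw [abs_zero]
        positivity
    · rw [if_neg hsq, ArithmeticFunction.moebius_eq_zero_of_not_squarefree hsq]
      simp
  refine ⟨habs.of_abs, habs, ?_⟩
  rw [HasDensity]
  have hlim : Filter.Tendsto (fun x : ℝ => ∑' d : ℕ,
      (if Nat.Coprime d k then (ArithmeticFunction.moebius d : ℝ) else 0) *
        (⌊x⌋₊ / fibL (d * k) : ℕ) / x) Filter.atTop
      (nhds (∑' d : ℕ, if Nat.Coprime d k then
          (ArithmeticFunction.moebius d : ℝ) / (fibL (d * k) : ℝ) else 0)) := by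
    refine tendsto_tsum_of_dominated_convergence habs (fun d => ?_) ?_
    · have h := (tendsto_nat_floor_mul_div_atTop (R := ℝ) (a := 1 / (fibL (d * k) : ℝ))
        (by positivity)).const_mul
        (if Nat.Coprime d k then (ArithmeticFunction.moebius d : ℝ) else 0)
      convert h using 2 with x
      · rw [← Nat.floor_div_natCast, mul_div_assoc, one_div_mul_eq_div]
      · split_ifs <;> ring
    · filter_upwards [Filter.eventually_gt_atTop 0] with x hx d
      have h1 : ((⌊x⌋₊ / fibL (d * k) : ℕ) : ℝ) / x ≤ 1 / (fibL (d * k) : ℝ) := by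
        rw [← Nat.floor_div_natCast, div_le_iff₀ hx, one_div_mul_eq_div]
        exact Nat.floor_le (by positivity)
      rw [Real.norm_eq_abs, mul_div_assoc, abs_mul,
        abs_of_nonneg (a := ((⌊x⌋₊ / fibL (d * k) : ℕ) : ℝ) / x) (by positivity)]
      refine (mul_le_mul_of_nonneg_left h1 (abs_nonneg _)).trans ?_
      split_ifs
      · rw [abs_div, Nat.abs_cast, mul_one_div]
      · simp
  refine hlim.congr' ?_
  filter_upwards [Filter.eventually_ge_atTop 0] with x hx
  rw [countIn_fibB_eq_tsum hk hx, tsum_div_const]
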